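/- Let G be a graph that has an r-rich tree-decomposition such that the subgraph of G induced by each bag is nonrepetitively c-colourable. Then π(G) ≤ c·4^r. -/

import Mathlib

/-- A colouring `φ` of (the vertices of) `G` is *nonrepetitive* if for no path of `G`
(with vertex sequence of even length `2k`) the sequence of colours on the first half
equals the sequence of colours on the second half. -/
def SimpleGraph.IsNonrepetitiveColouring {V α : Type*} (G : SimpleGraph V) (φ : V → α) : Prop :=
  ∀ ⦃u v : V⦄ (p : G.Walk u v), p.IsPath →
    ∀ k : ℕ, p.support.length = 2 * k →
      (p.support.map φ).take k ≠ (p.support.map φ).drop k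

/-- The *nonrepetitive chromatic number* `π(G)`: the least `n` such that `G` has a
nonrepetitive colouring with `n` colours. -/
noncomputable def SimpleGraph.nonrepChromNum {V : Type*} (G : SimpleGraph V) : ℕ :=
  sInf {n : ℕ | ∃ φ : V → Fin n, G.IsNonrepetitiveColouring φ}

/-- `(Tg, B)` is a tree-decomposition of `G`: `Tg` is a tree, every vertex of `G` is in
some bag, both endpoints of every edge of `G` lie in a common bag, and for every vertex
`v` of `G` the set of tree nodes whose bag contains `v` induces a (nonempty) connected
subgraph of the tree. -/
def SimpleGraph.IsTreeDecomp {V T : Type*} (G : SimpleGraph V) (Tg : SimpleGraph T)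
    (B : T → Finset V) : Prop :=
  Tg.IsTree ∧
  (∀ v : V, ∃ x : T, v ∈ B x) ∧
  (∀ ⦃u v : V⦄, G.Adj u v → ∃ x : T, u ∈ B x ∧ v ∈ B x) ∧
  (∀ v : V, (Tg.induce {x : T | v ∈ B x}).Connected)

/-- `G` has treewidth at most `k`: it has a tree-decomposition all of whose bags have
at most `k + 1` vertices. -/
def SimpleGraph.HasTreewidthAtMost {V : Type*} (G : SimpleGraph V) (k : ℕ) : Prop :=
  ∃ (T : Type) (Tg : SimpleGraph T) (B : T → Finset V),
    G.IsTreeDecomp Tg B ∧ ∀ x : T, (B x).card ≤ k + 1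

/-- The Thue–Morse sequence. -/
def thueMorse (n : ℕ) : Bool :=
  if n = 0 then false else xor (thueMorse (n / 2)) (n % 2 == 1)
decreasing_by omega

theorem thueMorse_two_mul (n : ℕ) : thueMorse (2 * n) = thueMorse n := by
  rcases Nat.eq_zero_or_pos n with rfl | h
  · rfl
  · rw [thueMorse, if_neg (by omega)]
    simp

theorem thueMorse_two_mul_add_one (n : ℕ) : thueMorse (2 * n + 1) = !thueMorse n := by
  rw [thueMorse, if_neg (by omega), show (2 * n + 1) / 2 = n by omega,
    show (2 * n + 1) % 2 = 1 by omega]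
  simp

theorem thueMorse_cube_free (m : ℕ) (h₁ : thueMorse m = thueMorse (m + 1))
    (h₂ : thueMorse (m + 1) = thueMorse (m + 2)) : False := by
  obtain ⟨k, rfl | rfl⟩ := Nat.even_or_odd' m
  · rw [thueMorse_two_mul, thueMorse_two_mul_add_one] at h₁
    cases h : thueMorse k <;> simp [h] at h₁
  · rw [show 2 * k + 1 + 1 = 2 * (k + 1) by ring, show 2 * k + 1 + 2 = 2 * (k + 1) + 1 by ring,
      thueMorse_two_mul, thueMorse_two_mul_add_one] at h₂
    cases h : thueMorse (k + 1) <;> simp [h] at h₂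

/-- The Thue–Morse sequence is overlap-free. -/
theorem thueMorse_overlap_free (p : ℕ) :
    ∀ m, 0 < p → (∀ i ≤ p, thueMorse (m + i) = thueMorse (m + i + p)) → False := by
  induction p using Nat.strong_induction_on with
  | _ p ih =>
  intro m hp h
  have inner (k : ℕ) : thueMorse (2 * k) ≠ thueMorse (2 * k + 1) := by
    rw [thueMorse_two_mul, thueMorse_two_mul_add_one]; cases thueMorse k <;> simp
  have outer (k : ℕ) (hk : thueMorse (2 * k + 1) ≠ thueMorse (2 * k + 2)) :
      thueMorse k = thueMorse (k + 1) := by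
    rw [show 2 * k + 2 = 2 * (k + 1) by ring, thueMorse_two_mul,
      thueMorse_two_mul_add_one] at hk
    revert hk
    cases thueMorse k <;> cases thueMorse (k + 1) <;> simp
  obtain ⟨q, rfl | rfl⟩ := Nat.even_or_odd' p
  · refine ih q (by omega) (m / 2) (by omega) fun i hi => ?_
    have key := h (2 * i) (by omega)
    obtain ⟨k, rfl | rfl⟩ := Nat.even_or_odd' m
    · rw [show 2 * k + 2 * i + 2 * q = 2 * (k + i + q) by ring,
        show 2 * k + 2 * i = 2 * (k + i) by ring, thueMorse_two_mul, thueMorse_two_mul] at key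
      rwa [show 2 * k / 2 = k by omega]
    · rw [show 2 * k + 1 + 2 * i + 2 * q = 2 * (k + i + q) + 1 by ring,
        show 2 * k + 1 + 2 * i = 2 * (k + i) + 1 by ring, thueMorse_two_mul_add_one,
        thueMorse_two_mul_add_one] at key
      rw [show (2 * k + 1) / 2 = k by omega]
      simpa using key
  · rcases Nat.eq_zero_or_pos q with rfl | hq
    · exact thueMorse_cube_free m (h 0 (by omega)) (h 1 (by omega))
    · have h₀ := h 0 (by omega)
      have h₁ := h 1 (by omega)
      have h₂ := h 2 (by omega)
      have h₃ := h 3 (by omega)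
      obtain ⟨k, rfl | rfl⟩ := Nat.even_or_odd' m
      · have e₀ := outer (k + q) (by
          have := inner k
          rw [show 2 * (k + q) + 1 = 2 * k + 0 + (2 * q + 1) by ring,
            show 2 * (k + q) + 2 = 2 * k + 1 + (2 * q + 1) by ring, ← h₀, ← h₁]
          exact this)
        have e₁ := outer (k + q + 1) (by
          have := inner (k + 1)
          rw [show 2 * (k + q + 1) + 1 = 2 * k + 2 + (2 * q + 1) by ring,
            show 2 * (k + q + 1) + 2 = 2 * k + 3 + (2 * q + 1) by ring, ← h₂, ← h₃]
          exact this)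
        exact thueMorse_cube_free _ e₀ e₁
      · have e₀ := outer k (by
          have := inner (k + q + 1)
          rw [show 2 * k + 1 = 2 * k + 1 + 0 by ring,
            show 2 * k + 1 + 0 + 1 = 2 * k + 1 + 1 by ring, h₀, h₁]
          convert this using 2 <;> ring_nf)
        have e₁ := outer (k + 1) (by
          have := inner (k + q + 2)
          rw [show 2 * (k + 1) + 1 = 2 * k + 1 + 2 by ring,
            show 2 * (k + 1) + 2 = 2 * k + 1 + 3 by ring, h₂, h₃]
          convert this using 2 <;> ring_nf)
        exact thueMorse_cube_free _ e₀ e₁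

/-- A sequence is square-free if no two adjacent blocks of equal positive length coincide. -/
def IsSquareFreeSeq {α : Type*} (x : ℕ → α) : Prop :=
  ∀ m p, 0 < p → ¬ ∀ i < p, x (m + i) = x (m + i + p)

/-- There is a square-free sequence on three symbols. -/
theorem exists_isSquareFreeSeq_lt_three : ∃ x : ℕ → ℕ, IsSquareFreeSeq x ∧ ∀ n, x n < 3 := by
  refine ⟨fun n => (thueMorse (n + 1)).toNat + 1 - (thueMorse n).toNat, ?_, fun n => ?_⟩
  · intro m p hp h
    have le (n : ℕ) : (thueMorse n).toNat ≤ 1 := Bool.toNat_le _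
    have shift : ∀ i ≤ p, (thueMorse (m + i + p)).toNat + (thueMorse m).toNat =
        (thueMorse (m + i)).toNat + (thueMorse (m + p)).toNat := by
      intro i
      induction i with
      | zero => intro; rw [add_zero, add_comm]
      | succ i ih =>
        intro hi
        have := ih (by omega)
        have h' := h i (by omega)
        simp only at h'
        rw [show m + i + p + 1 = m + (i + 1) + p by ring, add_assoc m i 1] at h'
        have := le (m + i)
        have := le (m + i + p)
        omega
    refine thueMorse_overlap_free p m hp fun i hi => ?_
    have h₁ := shift p le_rfl
    have h₂ := shift i hi
    have := le m
    have := le (m + p)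
    have := le (m + p + p)
    have key : (thueMorse (m + i)).toNat = (thueMorse (m + i + p)).toNat := by omega
    revert key
    cases thueMorse (m + i) <;> cases thueMorse (m + i + p) <;> simp
  · have := Bool.toNat_le (thueMorse (n + 1))
    dsimp only
    omega

/-- There is a square-free sequence on four symbols in which any three consecutive symbols are
distinct. -/
theorem exists_isSquareFreeSeq_lt_four :
    ∃ s : ℕ → ℕ, IsSquareFreeSeq s ∧ (∀ n, s n < 4) ∧ ∀ n, s n ≠ s (n + 2) := by
  obtain ⟨x, hx, hx3⟩ := exists_isSquareFreeSeq_lt_three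
  have hx1 (n : ℕ) : x n ≠ x (n + 1) := fun h =>
    hx n 1 one_pos fun i hi => by
      obtain rfl : i = 0 := by omega
      exact h
  let s (n : ℕ) : ℕ := if n % 3 = 0 then 3 else x (2 * (n / 3) + (n % 3 - 1))
  have s0 (n : ℕ) : s (3 * n) = 3 := by simp [s]
  have s1 (n : ℕ) : s (3 * n + 1) = x (2 * n) := by
    simp only [s]; rw [if_neg (by omega)]; congr 1; omega
  have s2 (n : ℕ) : s (3 * n + 2) = x (2 * n + 1) := by
    simp only [s]; rw [if_neg (by omega)]; congr 1; omega
  have s3 (n : ℕ) (h : n % 3 ≠ 0) : s n < 3 := by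
    simp only [s]; rw [if_neg h]; exact hx3 _
  have split (n : ℕ) : ∃ k, n = 3 * k ∨ n = 3 * k + 1 ∨ n = 3 * k + 2 := ⟨n / 3, by omega⟩
  have hs1 (n : ℕ) : s n ≠ s (n + 1) := by
    obtain ⟨k, rfl | rfl | rfl⟩ := split n
    · rw [s0]; exact (s3 _ (by omega)).ne'
    · rw [s1, s2]; exact hx1 _
    · rw [show 3 * k + 2 + 1 = 3 * (k + 1) by ring, s0]; exact (s3 _ (by omega)).ne
  have hs2 (n : ℕ) : s n ≠ s (n + 2) := by
    obtain ⟨k, rfl | rfl | rfl⟩ := split n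
    · rw [s0]; exact (s3 _ (by omega)).ne'
    · rw [show 3 * k + 1 + 2 = 3 * (k + 1) by ring, s0]; exact (s3 _ (by omega)).ne
    · rw [show 3 * k + 2 + 2 = 3 * (k + 1) + 1 by ring, s1, s2]; exact hx1 _
  refine ⟨s, fun m p hp h => ?_, fun n => ?_, hs2⟩
  · have h' (j : ℕ) (h₁ : m ≤ j) (h₂ : j < m + p) : s j = s (j + p) := by
      have := h (j - m) (by omega)
      rwa [show m + (j - m) = j by omega] at this
    rcases Nat.lt_or_ge p 3 with hp3 | hp3
    · interval_cases p
      · exact hs1 m (h' m (by omega) (by omega))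
      · exact hs2 m (h' m (by omega) (by omega))
    · obtain ⟨q, rfl⟩ : 3 ∣ p := by
        by_contra hd
        have := h' (3 * ((m + 2) / 3)) (by omega) (by omega)
        rw [s0] at this
        have := s3 (3 * ((m + 2) / 3) + p) (by omega)
        omega
      refine hx (2 * (m / 3) + (m % 3 - 1)) (2 * q) (by omega) fun i hi => ?_
      generalize hj : 2 * (m / 3) + (m % 3 - 1) + i = j
      obtain ⟨k, rfl | rfl⟩ := Nat.even_or_odd' j
      · have := h' (3 * k + 1) (by omega) (by omega)
        rwa [show 3 * k + 1 + 3 * q = 3 * (k + q) + 1 by ring, s1, s1, mul_add] at this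
      · have := h' (3 * k + 2) (by omega) (by omega)
        rw [show 3 * k + 2 + 3 * q = 3 * (k + q) + 2 by ring, s2, s2] at this
        rw [this]; congr 1; ring
  · by_cases hn : n % 3 = 0
    · simp [s, hn]
    · have := s3 n hn
      omega

/-- Discrete intermediate value property. -/
theorem exists_le_eq_of_lazy_steps {a : ℕ → ℕ} {n : ℕ}
    (ha : ∀ i < n, a i ≤ a (i + 1) + 1 ∧ a (i + 1) ≤ a i + 1) {p : ℕ}
    (hp : a 0 ≤ p ∧ p ≤ a n ∨ a n ≤ p ∧ p ≤ a 0) : ∃ j ≤ n, a j = p := by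
  induction n with
  | zero => exact ⟨0, le_rfl, by omega⟩
  | succ n ih =>
    by_cases h : a (n + 1) = p
    · exact ⟨n + 1, le_rfl, h⟩
    · have := ha n (by omega)
      obtain ⟨j, hj, e⟩ := ih (fun i hi => ha i (by omega)) (by omega)
      exact ⟨j, by omega, e⟩

/-- Two lazy walks on `ℕ` that see the same colours are related by a translation or a reflection,
provided that any three consecutive colours are distinct. -/
theorem translation_or_reflection_of_lazy_steps {s a b : ℕ → ℕ}
    (hloc : ∀ p q, s p = s q → p ≤ q + 2 → q ≤ p + 2 → p = q) {n : ℕ}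
    (ha : ∀ i < n, a i ≤ a (i + 1) + 1 ∧ a (i + 1) ≤ a i + 1)
    (hb : ∀ i < n, b i ≤ b (i + 1) + 1 ∧ b (i + 1) ≤ b i + 1)
    (hs : ∀ i ≤ n, s (a i) = s (b i)) :
    (∀ j ≤ n, b j + a 0 = b 0 + a j) ∨ (∀ j ≤ n, b j + a j = b 0 + a 0) := by
  suffices H : (∀ j ≤ n, a j = a 0 ∧ b j = b 0) ∨
      (((∀ j ≤ n, b j + a 0 = b 0 + a j) ∨ (∀ j ≤ n, b j + a j = b 0 + a 0)) ∧
        ∃ j ≤ n, a j = a n + 1 ∨ a j + 1 = a n) by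
    rcases H with H | H
    · exact Or.inl fun j hj => by have := H j hj; omega
    · exact H.1
  induction n with
  | zero =>
    refine Or.inl fun j hj => ?_
    obtain rfl : j = 0 := by omega
    exact ⟨rfl, rfl⟩
  | succ n ih =>
    have an := ha n (by omega)
    have bn := hb n (by omega)
    have s₀ := hs n (by omega)
    have s₁ := hs (n + 1) le_rfl
    have stat : a (n + 1) = a n ↔ b (n + 1) = b n := by
      constructor <;> intro h
      · exact hloc _ _ (by rw [← s₁, h, s₀]) (by omega) (by omega)
      · exact hloc _ _ (by rw [s₁, h, s₀]) (by omega) (by omega)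
    rcases ih (fun i hi => ha i (by omega)) (fun i hi => hb i (by omega))
      (fun i hi => hs i (by omega)) with H | ⟨H, j, hj, hja⟩
    · have Hn := H n le_rfl
      by_cases h : a (n + 1) = a n
      · left
        intro j hj
        rcases Nat.lt_or_ge n j with hnj | hnj
        · obtain rfl : j = n + 1 := by omega
          have := stat.1 h
          omega
        · exact H j hnj
      · right
        have h' : b (n + 1) ≠ b n := fun h' => h (stat.2 h')
        refine ⟨?_, n, by omega, by omega⟩
        by_cases hd : b (n + 1) + a 0 = b 0 + a (n + 1)
        · left
          intro j hj
          rcases Nat.lt_or_ge n j with hnj | hnj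
          · obtain rfl : j = n + 1 := by omega
            exact hd
          · have := H j hnj
            omega
        · right
          intro j hj
          rcases Nat.lt_or_ge n j with hnj | hnj
          · obtain rfl : j = n + 1 := by omega
            omega
          · have := H j hnj
            omega
    · right
      have sj := hs j (by omega)
      have back (hbj : b j ≤ b n + 1) (hbj' : b n ≤ b j + 1) :
          a (n + 1) = a j ↔ b (n + 1) = b j := by
        constructor <;> intro h
        · exact hloc _ _ (by rw [← s₁, h, sj]) (by omega) (by omega)
        · exact hloc _ _ (by rw [s₁, h, sj]) (by omega) (by omega)
      refine ⟨?_, ?_⟩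
      · rcases H with H | H
        · left
          intro i hi
          rcases Nat.lt_or_ge n i with hni | hni
          · obtain rfl : i = n + 1 := by omega
            have := H n le_rfl
            have := H j hj
            have := back (by omega) (by omega)
            omega
          · exact H i hni
        · right
          intro i hi
          rcases Nat.lt_or_ge n i with hni | hni
          · obtain rfl : i = n + 1 := by omega
            have := H n le_rfl
            have := H j hj
            have := back (by omega) (by omega)
            omega
          · exact H i hni
      · by_cases h : a (n + 1) = a n
        · exact ⟨j, by omega, by omega⟩
        · exact ⟨n, by omega, by omega⟩

/-- If `s` is square-free with any three consecutive symbols distinct, then a lazy walk on `ℕ`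
that is repetitively coloured by `s` traverses the same walk twice. -/
theorem IsSquareFreeSeq.eq_of_lazy_walk {s : ℕ → ℕ} (hsq : IsSquareFreeSeq s)
    (hs2 : ∀ n, s n ≠ s (n + 2)) {f : ℕ → ℕ} {t : ℕ}
    (hf : ∀ i, i + 1 < 2 * t → f i ≤ f (i + 1) + 1 ∧ f (i + 1) ≤ f i + 1)
    (hs : ∀ i < t, s (f i) = s (f (t + i))) : ∀ i < t, f i = f (t + i) := by
  rcases Nat.eq_zero_or_pos t with rfl | ht
  · intro i hi; omega
  obtain ⟨n, rfl⟩ : ∃ n, t = n + 1 := ⟨t - 1, by omega⟩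
  have hs1 (n : ℕ) : s n ≠ s (n + 1) := fun h => hsq n 1 one_pos fun i hi => by
    obtain rfl : i = 0 := by omega
    exact h
  have hloc : ∀ p q, s p = s q → p ≤ q + 2 → q ≤ p + 2 → p = q := by
    intro p q h h₁ h₂
    by_contra hne
    obtain rfl | rfl | rfl | rfl : p = q + 1 ∨ p = q + 2 ∨ q = p + 1 ∨ q = p + 2 := by omega
    · exact hs1 _ h.symm
    · exact hs2 _ h.symm
    · exact hs1 _ h
    · exact hs2 _ h
  have ha : ∀ i < n, f i ≤ f (i + 1) + 1 ∧ f (i + 1) ≤ f i + 1 := fun i hi => hf i (by omega)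
  have hb : ∀ i < n, f (n + 1 + i) ≤ f (n + 1 + (i + 1)) + 1 ∧
      f (n + 1 + (i + 1)) ≤ f (n + 1 + i) + 1 := fun i hi => hf (n + 1 + i) (by omega)
  have hmid := hf n (by omega)
  by_cases h0 : f 0 = f (n + 1)
  · intro i
    induction i with
    | zero => intro _; exact h0
    | succ i ih =>
      intro hi
      have := ih (by omega)
      have := ha i (by omega)
      have := hb i (by omega)
      exact hloc _ _ (hs _ hi) (by omega) (by omega)
  exfalso
  have ivt (p : ℕ) (hp : f 0 ≤ p ∧ p ≤ f n ∨ f n ≤ p ∧ p ≤ f 0) : ∃ j ≤ n, f j = p :=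
    exists_le_eq_of_lazy_steps ha hp
  rcases translation_or_reflection_of_lazy_steps (b := fun i => f (n + 1 + i)) hloc ha hb
    (fun i hi => hs i (by omega)) with H | H
  · simp only [add_zero] at H
    have e (j : ℕ) (hj : j ≤ n) : s (f j) = s (f (n + 1 + j)) := hs j (by omega)
    rcases Nat.lt_or_gt_of_ne h0 with hlt | hlt
    · refine hsq (f 0) (f (n + 1) - f 0) (by omega) fun i hi => ?_
      obtain ⟨j, hj, h⟩ := ivt (f 0 + i) (by omega)
      have := H j hj
      rw [← h, e j hj]
      congr 1
      omega
    · obtain ⟨k, hk, hfk⟩ := ivt (f (n + 1) + 1) (by omega)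
      have hk' := H k hk
      refine hsq (f (n + 1 + k)) (f 0 - f (n + 1)) (by omega) fun i hi => ?_
      obtain ⟨j, hj, h⟩ := ivt (f (n + 1) + 1 + i) (by omega)
      have := H j hj
      rw [show f (n + 1 + k) + i + (f 0 - f (n + 1)) = f j by omega, e j hj]
      congr 1
      omega
  · simp only [add_zero] at H
    have refl (p : ℕ) (hp : f 0 ≤ p ∧ p ≤ f n ∨ f n ≤ p ∧ p ≤ f 0) (q : ℕ)
        (hq : p + q = f 0 + f (n + 1)) : s p = s q := by
      obtain ⟨j, hj, rfl⟩ := ivt p hp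
      have := H j hj
      rw [hs j (by omega)]
      congr 1
      omega
    obtain ⟨c, hc | hc⟩ := Nat.even_or_odd' (f 0 + f (n + 1))
    · rcases Nat.lt_or_gt_of_ne h0 with hlt | hlt
      · have := hloc _ _ (refl (c - 1) (by omega) (c + 1) (by omega))
        omega
      · have := hloc _ _ (refl (c + 1) (by omega) (c - 1) (by omega))
        omega
    · rcases Nat.lt_or_gt_of_ne h0 with hlt | hlt
      · have := hloc _ _ (refl c (by omega) (c + 1) (by omega))
        omega
      · have := hloc _ _ (refl (c + 1) (by omega) c (by omega))
        omega

namespace SimpleGraph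

variable {V : Type*} {G : SimpleGraph V}

/-- `φ` colours the vertices of `S` with colours less than `n` such that no path of `G` inside `S`
is repetitively coloured. -/
def IsNonrepOn (G : SimpleGraph V) (S : Set V) (n : ℕ) (φ : V → ℕ) : Prop :=
  (∀ v ∈ S, φ v < n) ∧ ∀ L₁ L₂ : List V, L₁ ≠ [] → (L₁ ++ L₂).Nodup →
    (L₁ ++ L₂).IsChain G.Adj → (∀ v ∈ L₁ ++ L₂, v ∈ S) → L₁.map φ ≠ L₂.map φ

theorem IsNonrepOn.mono {S S' : Set V} {n : ℕ} {φ : V → ℕ} (h : G.IsNonrepOn S n φ)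
    (hS : S' ⊆ S) : G.IsNonrepOn S' n φ :=
  ⟨fun v hv => h.1 v (hS hv), fun L₁ L₂ h₁ h₂ h₃ h₄ =>
    h.2 L₁ L₂ h₁ h₂ h₃ fun v hv => hS (h₄ v hv)⟩

/-- `G.StepAbove S ℓ d` is adjacency to a vertex of `S` whose level exceeds `d`. -/
def StepAbove (G : SimpleGraph V) (S : Set V) (ℓ : V → ℕ) (d : ℕ) (a b : V) : Prop :=
  G.Adj a b ∧ b ∈ S ∧ d < ℓ b

/-- A layering `ℓ` of `G[S]` is shadow-complete if any two vertices of a layer `d` that are joined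
by a path of `G[S]` with all internal vertices above `d` are adjacent. -/
def IsShadowComplete (G : SimpleGraph V) (S : Set V) (ℓ : V → ℕ) : Prop :=
  ∀ ⦃u z w : V⦄, u ∈ S → w ∈ S → ℓ w = ℓ u → Relation.ReflTransGen (G.StepAbove S ℓ (ℓ u)) u z →
    G.Adj z w → u ≠ w → G.Adj u w

/-- A layering of `G[S]`: the levels of adjacent vertices differ by at most one. -/
def IsLayering (G : SimpleGraph V) (S : Set V) (ℓ : V → ℕ) : Prop :=
  ∀ ⦃a b : V⦄, a ∈ S → b ∈ S → G.Adj a b → ℓ a ≤ ℓ b + 1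

theorem IsShadowComplete.isChain_cons_filter {S : Set V} {ℓ : V → ℕ}
    (hℓ : G.IsShadowComplete S ℓ) {u z : V} {L : List V} (hu : u ∈ S)
    (huz : Relation.ReflTransGen (G.StepAbove S ℓ (ℓ u)) u z) (hL : (z :: L).IsChain G.Adj)
    (hLS : ∀ v ∈ L, v ∈ S) (hLd : ∀ v ∈ L, ℓ u ≤ ℓ v) (hnd : (u :: L).Nodup) :
    (u :: L.filter (fun v => ℓ v = ℓ u)).IsChain G.Adj := by
  induction L generalizing u z with
  | nil => simp
  | cons y L ih =>
    rw [List.isChain_cons_cons] at hL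
    simp only [List.mem_cons, forall_eq_or_imp, List.nodup_cons, not_or] at hLS hLd hnd
    by_cases hy : ℓ y = ℓ u
    · rw [List.filter_cons_of_pos (by simpa using hy), List.isChain_cons_cons]
      refine ⟨hℓ hu hLS.1 hy huz hL.1 hnd.1.1, ?_⟩
      rw [← hy]
      refine ih hLS.1 .refl hL.2 hLS.2 (by rw [hy]; exact hLd.2) ?_
      simpa using hnd.2
    · rw [List.filter_cons_of_neg (by simpa using hy)]
      refine ih hu (huz.tail ⟨hL.1, hLS.1, by omega⟩) hL.2 hLS.2 hLd.2 ?_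
      simpa using ⟨hnd.1.2, hnd.2.2⟩

theorem IsShadowComplete.isChain_filter {S : Set V} {ℓ : V → ℕ}
    (hℓ : G.IsShadowComplete S ℓ) {d : ℕ} {L : List V} (hL : L.IsChain G.Adj)
    (hLS : ∀ v ∈ L, v ∈ S) (hLd : ∀ v ∈ L, d ≤ ℓ v) (hnd : L.Nodup) :
    (L.filter (fun v => ℓ v = d)).IsChain G.Adj := by
  induction L with
  | nil => simp
  | cons y L ih =>
    simp only [List.mem_cons, forall_eq_or_imp] at hLS hLd
    by_cases hy : ℓ y = d
    · subst hy
      rw [List.filter_cons_of_pos (by simp)]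
      exact hℓ.isChain_cons_filter hLS.1 .refl hL hLS.2 hLd.2 hnd
    · rw [List.filter_cons_of_neg (by simpa using hy)]
      exact ih hL.of_cons hLS.2 hLd.2 hnd.of_cons

theorem _root_.List.map_filter_eq_map_filter {α β : Type*} {f : α → β} {g : α → ℕ} {d : ℕ} :
    ∀ {L₁ L₂ : List α}, L₁.map (fun v => (g v, f v)) = L₂.map (fun v => (g v, f v)) →
      (L₁.filter (fun v => g v = d)).map f = (L₂.filter (fun v => g v = d)).map f
  | [], [] => by simp
  | [], _ :: _ => by simp
  | _ :: _, [] => by simp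
  | a :: L₁, b :: L₂ => by
    intro h
    simp only [List.map_cons, List.cons.injEq, Prod.mk.injEq] at h
    have ih := List.map_filter_eq_map_filter (d := d) h.2
    by_cases hd : g b = d
    · rw [List.filter_cons_of_pos (by simpa [h.1.1] using hd),
        List.filter_cons_of_pos (by simpa using hd), List.map_cons, List.map_cons, ih, h.1.2]
    · rw [List.filter_cons_of_neg (by simpa [h.1.1] using hd),
        List.filter_cons_of_neg (by simpa using hd), ih]

/-- If `G[S]` has a shadow-complete layering whose layers are nonrepetitively `n`-colourable, then
`G[S]` is nonrepetitively `4 * n`-colourable. -/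
theorem IsShadowComplete.exists_isNonrepOn {S : Set V} {ℓ : V → ℕ} {n : ℕ}
    (hℓ : G.IsShadowComplete S ℓ) (hlay : G.IsLayering S ℓ)
    (h : ∀ d, ∃ φ, G.IsNonrepOn {v ∈ S | ℓ v = d} n φ) : ∃ φ, G.IsNonrepOn S (n * 4) φ := by
  choose φ hφ using h
  obtain ⟨s, hsq, hs4, hs2⟩ := exists_isSquareFreeSeq_lt_four
  refine ⟨fun v => s (ℓ v) + 4 * φ (ℓ v) v, fun v hv => ?_, fun L₁ L₂ hne hnd hch hS heq => ?_⟩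
  · have := (hφ (ℓ v)).1 v ⟨hv, rfl⟩
    have := hs4 (ℓ v)
    dsimp only
    omega
  have hlen : L₁.length = L₂.length := by simpa using congrArg List.length heq
  have hpair (i : ℕ) (h₁ : i < L₁.length) (h₂ : i < L₂.length) :
      s (ℓ L₁[i]) = s (ℓ L₂[i]) ∧ φ (ℓ L₁[i]) L₁[i] = φ (ℓ L₂[i]) L₂[i] := by
    have := List.getElem_of_eq heq (i := i) (by simpa using h₁)
    simp only [List.getElem_map] at this
    have := hs4 (ℓ L₁[i])
    have := hs4 (ℓ L₂[i])
    omega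
  let f (i : ℕ) : ℕ := ((L₁ ++ L₂).map ℓ).getD i 0
  have hf₁ (i : ℕ) (hi : i < L₁.length) : f i = ℓ L₁[i] := by
    simp only [f]
    rw [List.getD_eq_getElem _ _ (by rw [List.length_map, List.length_append]; omega),
      List.getElem_map, List.getElem_append_left hi]
  have hf₂ (i : ℕ) (hi : i < L₂.length) : f (L₁.length + i) = ℓ L₂[i] := by
    simp [f, hi]
  have hlev : ∀ i < L₁.length, f i = f (L₁.length + i) := by
    refine hsq.eq_of_lazy_walk hs2 (fun i hi => ?_) fun i hi => ?_
    · have hi' : i + 1 < (L₁ ++ L₂).length := by rw [List.length_append]; omega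
      have hadj := List.isChain_iff_getElem.1 hch i hi'
      have e₀ : f i = ℓ (L₁ ++ L₂)[i] := by
        simp only [f]
        rw [List.getD_eq_getElem _ _ (by rw [List.length_map]; omega), List.getElem_map]
      have e₁ : f (i + 1) = ℓ (L₁ ++ L₂)[i + 1] := by
        simp only [f]
        rw [List.getD_eq_getElem _ _ (by rw [List.length_map]; omega), List.getElem_map]
      rw [e₀, e₁]
      have m₀ := hS _ (List.getElem_mem (show i < (L₁ ++ L₂).length by omega))
      have m₁ := hS _ (List.getElem_mem hi')
      exact ⟨hlay m₀ m₁ hadj, hlay m₁ m₀ hadj.symm⟩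
    · rw [hf₁ i hi, hf₂ i (by omega)]
      exact (hpair i hi (by omega)).1
  have hmap : L₁.map (fun v => (ℓ v, φ (ℓ v) v)) = L₂.map (fun v => (ℓ v, φ (ℓ v) v)) := by
    refine List.ext_getElem (by simpa using hlen) fun i h₁ h₂ => ?_
    simp only [List.length_map] at h₁ h₂
    simp only [List.getElem_map, Prod.mk.injEq]
    exact ⟨by rw [← hf₁, ← hf₂, hlev i h₁], (hpair i h₁ h₂).2⟩
  obtain ⟨v₀, hv₀, hmin⟩ := Set.exists_min_image {v | v ∈ L₁} ℓ (List.finite_toSet L₁)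
    (List.exists_mem_of_ne_nil L₁ hne)
  have hmin' : ∀ v ∈ L₁ ++ L₂, ℓ v₀ ≤ ℓ v := by
    intro v hv
    rcases List.mem_append.1 hv with hv | hv
    · exact hmin v hv
    · obtain ⟨i, hi, rfl⟩ := List.getElem_of_mem hv
      rw [← hf₂ i hi, ← hlev i (by omega), hf₁ i (by omega)]
      exact hmin _ (List.getElem_mem _)
  refine (hφ (ℓ v₀)).2 (L₁.filter (fun v => ℓ v = ℓ v₀)) (L₂.filter (fun v => ℓ v = ℓ v₀))
    ?_ ?_ ?_ ?_ ?_
  · exact List.ne_nil_of_mem (a := v₀) (by simpa using hv₀)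
  · rw [← List.filter_append]
    exact hnd.filter _
  · rw [← List.filter_append]
    exact hℓ.isChain_filter hch hS hmin' hnd
  · intro v hv
    rw [← List.filter_append, List.mem_filter] at hv
    exact ⟨hS v hv.1, by simpa using hv.2⟩
  · have key (L : List V) : (L.filter (fun v => ℓ v = ℓ v₀)).map (φ (ℓ v₀)) =
        (L.filter (fun v => ℓ v = ℓ v₀)).map (fun v => φ (ℓ v) v) := by
      refine List.map_congr_left fun v hv => ?_
      have : ℓ v = ℓ v₀ := by simpa using (List.mem_filter.1 hv).2
      rw [this]
    rw [key, key]
    exact List.map_filter_eq_map_filter hmap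

/-- There is no edge of `G` between `S₁ \ S₂` and `S₂ \ S₁`. -/
def IsSeparation (G : SimpleGraph V) (S₁ S₂ : Set V) : Prop :=
  ∀ ⦃a b : V⦄, a ∈ S₁ → b ∈ S₂ → G.Adj a b → a ∈ S₂ ∨ b ∈ S₁

theorem IsSeparation.symm {S₁ S₂ : Set V} (h : G.IsSeparation S₁ S₂) : G.IsSeparation S₂ S₁ :=
  fun _ _ ha hb hab => (h hb ha hab.symm).symm

theorem IsSeparation.subset_or_subset {S₁ S₂ K : Set V} (h : G.IsSeparation S₁ S₂)
    (hK : G.IsClique K) (hKS : K ⊆ S₁ ∪ S₂) : K ⊆ S₁ ∨ K ⊆ S₂ := by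
  by_contra! hne
  obtain ⟨⟨a, ha, ha₁⟩, b, hb, hb₂⟩ := hne.imp Set.not_subset.1 Set.not_subset.1
  have ha₂ := (hKS ha).resolve_left ha₁
  have hb₁ := (hKS hb).resolve_right hb₂
  have hab : b ≠ a := fun h => ha₁ (h ▸ hb₁)
  exact (h hb₁ ha₂ (hK hb ha hab)).elim hb₂ ha₁

/-- The sets of vertices of `G` that are obtained from nonrepetitively `n`-colourable sets by
repeatedly gluing along cliques with at most `r` vertices. -/
inductive IsRichSum (G : SimpleGraph V) (n r : ℕ) : Set V → Prop
  | of_isNonrepOn {S : Set V} {φ : V → ℕ} (h : G.IsNonrepOn S n φ) : IsRichSum G n r S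
  | union {S₁ S₂ : Set V} (h₁ : IsRichSum G n r S₁) (h₂ : IsRichSum G n r S₂)
      (hsep : G.IsSeparation S₁ S₂) (hcl : G.IsClique (S₁ ∩ S₂)) (hr : (S₁ ∩ S₂).ncard ≤ r) :
      IsRichSum G n r (S₁ ∪ S₂)

theorem IsSeparation.chain_subset {S₁ S₂ : Set V} (hsep : G.IsSeparation S₁ S₂)
    (hdisj : S₁ ∩ S₂ = ∅) {L : List V} (hL : L.IsChain G.Adj) (hS : ∀ v ∈ L, v ∈ S₁ ∪ S₂) :
    (∀ v ∈ L, v ∈ S₁) ∨ (∀ v ∈ L, v ∈ S₂) := by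
  have hd (v : V) (h₁ : v ∈ S₁) (h₂ : v ∈ S₂) : False := by
    have : v ∈ S₁ ∩ S₂ := ⟨h₁, h₂⟩
    simp [hdisj] at this
  induction L with
  | nil => simp
  | cons a L ih =>
    simp only [List.mem_cons, forall_eq_or_imp] at hS ⊢
    cases L with
    | nil => simpa using hS.1
    | cons b L =>
      rw [List.isChain_cons_cons] at hL
      rcases ih hL.2 hS.2 with h | h
      · refine Or.inl ⟨hS.1.resolve_right fun ha => ?_, h⟩
        have hb := h b (by simp)
        exact (hsep hb ha hL.1.symm).elim (hd b hb) (fun ha' => hd a ha' ha)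
      · refine Or.inr ⟨hS.1.resolve_left fun ha => ?_, h⟩
        have hb := h b (by simp)
        exact (hsep ha hb hL.1).elim (hd a ha) (fun hb' => hd b hb' hb)

theorem IsRichSum.exists_isNonrepOn_zero [Finite V] {n : ℕ} {S : Set V}
    (h : G.IsRichSum n 0 S) : ∃ φ, G.IsNonrepOn S n φ := by
  classical
  induction h with
  | of_isNonrepOn h => exact ⟨_, h⟩
  | @union S₁ S₂ _ _ hsep _ hr ih₁ ih₂ =>
    obtain ⟨φ₁, h₁⟩ := ih₁
    obtain ⟨φ₂, h₂⟩ := ih₂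
    have hdisj : S₁ ∩ S₂ = ∅ := (Set.ncard_eq_zero (Set.toFinite _)).1 (by omega)
    refine ⟨fun v => if v ∈ S₁ then φ₁ v else φ₂ v, fun v hv => ?_,
      fun L₁ L₂ hne hnd hch hS heq => ?_⟩
    · dsimp only
      split_ifs with hv₁
      · exact h₁.1 v hv₁
      · exact h₂.1 v (hv.resolve_left hv₁)
    · rcases hsep.chain_subset hdisj hch hS with hS' | hS'
      · refine h₁.2 L₁ L₂ hne hnd hch hS' ?_
        have key (L : List V) (hL : ∀ v ∈ L, v ∈ S₁) :
            L.map (fun v => if v ∈ S₁ then φ₁ v else φ₂ v) = L.map φ₁ :=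
          List.map_congr_left fun v hv => if_pos (hL v hv)
        rwa [key L₁ fun v hv => hS' v (by simp [hv]),
          key L₂ fun v hv => hS' v (by simp [hv])] at heq
      · refine h₂.2 L₁ L₂ hne hnd hch hS' ?_
        have key (L : List V) (hL : ∀ v ∈ L, v ∈ S₂) :
            L.map (fun v => if v ∈ S₁ then φ₁ v else φ₂ v) = L.map φ₂ :=
          List.map_congr_left fun v hv => if_neg fun hv₁ => by
            have : v ∈ S₁ ∩ S₂ := ⟨hv₁, hL v hv⟩
            simp [hdisj] at this
        rwa [key L₁ fun v hv => hS' v (by simp [hv]),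
          key L₂ fun v hv => hS' v (by simp [hv])] at heq

theorem IsShadowComplete.of_eq_add {S : Set V} {ℓ ℓ' : V → ℕ} (h : G.IsShadowComplete S ℓ)
    (k : ℕ) (hk : ∀ v ∈ S, ℓ' v = k + ℓ v) : G.IsShadowComplete S ℓ' := by
  intro u z w hu hw huw huz
  refine h hu hw (by have := hk u hu; have := hk w hw; omega)
    (Relation.ReflTransGen.mono (fun a b hab => ?_) _ _ huz)
  refine ⟨hab.1, hab.2.1, ?_⟩
  have := hab.2.2
  have := hk u hu
  have := hk b hab.2.1
  omega

theorem IsLayering.of_eq_add {S : Set V} {ℓ ℓ' : V → ℕ} (h : G.IsLayering S ℓ)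
    (k : ℕ) (hk : ∀ v ∈ S, ℓ' v = k + ℓ v) : G.IsLayering S ℓ' := by
  intro a b ha hb hab
  have := h ha hb hab
  have := hk a ha
  have := hk b hb
  omega

theorem IsSeparation.mem_of_adj {S₁ S₂ : Set V} (hsep : G.IsSeparation S₁ S₂) {a b : V}
    (hab : G.Adj a b) (hb : b ∈ S₁ ∪ S₂) (ha : a ∈ S₂) (ha₁ : a ∉ S₁) : b ∈ S₂ := by
  by_contra hb₂
  exact (hsep (hb.resolve_right hb₂) ha hab.symm).elim hb₂ ha₁

theorem IsLayering.union {S₁ S₂ : Set V} {ℓ : V → ℕ} (h₁ : G.IsLayering S₁ ℓ)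
    (h₂ : G.IsLayering S₂ ℓ) (hsep : G.IsSeparation S₁ S₂) : G.IsLayering (S₁ ∪ S₂) ℓ := by
  intro a b ha hb hab
  by_cases h : a ∈ S₂ ∧ b ∈ S₂
  · exact h₂ h.1 h.2 hab
  by_cases h' : a ∈ S₁ ∧ b ∈ S₁
  · exact h₁ h'.1 h'.2 hab
  exfalso
  simp only [Set.mem_union] at ha hb
  have e₁ := @hsep a b
  have e₂ := @hsep b a
  have := hab.symm
  tauto

theorem StepAbove.mono {S S' : Set V} {ℓ : V → ℕ} {d : ℕ} {a b : V}
    (h : G.StepAbove S ℓ d a b) (hb : b ∈ S') : G.StepAbove S' ℓ d a b :=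
  ⟨h.1, hb, h.2.2⟩

theorem mem_of_reflTransGen_stepAbove {S : Set V} {ℓ : V → ℕ} {d : ℕ} {u z : V} (hu : u ∈ S)
    (h : Relation.ReflTransGen (G.StepAbove S ℓ d) u z) : z ∈ S := by
  rcases h.cases_tail with rfl | ⟨_, _, h⟩
  exacts [hu, h.2.1]

/-- Gluing shadow-complete layerings along a clique. -/
theorem IsShadowComplete.union {S₁ S₂ : Set V} {ℓ : V → ℕ} (h₁ : G.IsShadowComplete S₁ ℓ)
    (h₂ : G.IsShadowComplete S₂ ℓ) (hsep : G.IsSeparation S₁ S₂) (hcl : G.IsClique (S₁ ∩ S₂))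
    (hle : ∀ q ∈ S₁ ∩ S₂, ∀ v ∈ S₂, v ∉ S₁ → ℓ q ≤ ℓ v) : G.IsShadowComplete (S₁ ∪ S₂) ℓ := by
  intro u z w hu hw hwu huz hzw huw
  have hz := mem_of_reflTransGen_stepAbove hu huz
  by_cases hw₁ : w ∈ S₁
  · by_cases hu₁ : u ∈ S₁
    · have inv : (z ∈ S₁ ∧ Relation.ReflTransGen (G.StepAbove S₁ ℓ (ℓ u)) u z) ∨
          (z ∉ S₁ ∧ z ∈ S₂ ∧ ∃ q ∈ S₁ ∩ S₂,
            Relation.ReflTransGen (G.StepAbove S₁ ℓ (ℓ u)) u q) := by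
        clear hzw hz
        induction huz with
        | refl => exact Or.inl ⟨hu₁, .refl⟩
        | @tail a b _ hab ih =>
          by_cases hb₁ : b ∈ S₁
          · refine Or.inl ⟨hb₁, ?_⟩
            rcases ih with ⟨_, h⟩ | ⟨ha₁, ha₂, q, hq, h⟩
            · exact h.tail (hab.mono hb₁)
            · have hb : b ∈ S₁ ∩ S₂ := ⟨hb₁, hsep.mem_of_adj hab.1 hab.2.1 ha₂ ha₁⟩
              by_cases hqb : q = b
              · exact hqb ▸ h
              · exact h.tail ⟨hcl hq hb hqb, hb₁, hab.2.2⟩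
          · refine Or.inr ⟨hb₁, hab.2.1.resolve_left hb₁, ?_⟩
            rcases ih with ⟨ha₁, h⟩ | ⟨_, _, h⟩
            · exact ⟨a, ⟨ha₁, (hsep ha₁ (hab.2.1.resolve_left hb₁) hab.1).resolve_right hb₁⟩, h⟩
            · exact h
      rcases inv with ⟨_, h⟩ | ⟨hz₁, hz₂, q, hq, h⟩
      · exact h₁ hu₁ hw₁ hwu h hzw huw
      · have hw' : w ∈ S₁ ∩ S₂ := ⟨hw₁, hsep.mem_of_adj hzw hw hz₂ hz₁⟩
        by_cases hqw : q = w
        · subst hqw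
          rcases h.cases_tail with e | ⟨_, _, e⟩
          · exact absurd e.symm huw
          · exact absurd e.2.2 (by omega)
        · exact h₁ hu₁ hw₁ hwu h (hcl hq hw' hqw) huw
    · have hu₂ := hu.resolve_left hu₁
      have inv : (z ∉ S₁ ∧ z ∈ S₂) ∧ Relation.ReflTransGen (G.StepAbove S₂ ℓ (ℓ u)) u z := by
        clear hzw hz
        induction huz with
        | refl => exact ⟨⟨hu₁, hu₂⟩, .refl⟩
        | @tail a b _ hab ih =>
          have hb₂ := hsep.mem_of_adj hab.1 hab.2.1 ih.1.2 ih.1.1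
          refine ⟨⟨fun hb₁ => ?_, hb₂⟩, ih.2.tail (hab.mono hb₂)⟩
          have := hle b ⟨hb₁, hb₂⟩ u hu₂ hu₁
          have := hab.2.2
          omega
      exact h₂ hu₂ (hsep.mem_of_adj hzw hw inv.1.2 inv.1.1) hwu inv.2 hzw huw
  · have hw₂ := hw.resolve_left hw₁
    have inv : z ∈ S₂ → u ∈ S₂ ∧ Relation.ReflTransGen (G.StepAbove S₂ ℓ (ℓ u)) u z := by
      clear hzw hz
      induction huz with
      | refl => exact fun h => ⟨h, .refl⟩
      | @tail a b hua hab ih =>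
        intro hb₂
        have ha := mem_of_reflTransGen_stepAbove hu hua
        have hb₁ : b ∉ S₁ := fun hb₁ => by
          have := hle b ⟨hb₁, hb₂⟩ w hw₂ hw₁
          have := hab.2.2
          omega
        have := ih (hsep.mem_of_adj hab.1.symm ha hb₂ hb₁)
        exact ⟨this.1, this.2.tail (hab.mono hb₂)⟩
    have := inv (hsep.mem_of_adj hzw.symm hz hw₂ hw₁)
    exact h₂ this.1 hw₂ hwu this.2 hzw huw

/-- Every clique of `G[S]` is the bottom layer of a shadow-complete layering of `G[S]` all of whose
layers are rich sums along cliques of order at most `r`. -/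
def HasRichLayerings (G : SimpleGraph V) (n r : ℕ) (S : Set V) : Prop :=
  ∀ K ⊆ S, G.IsClique K → ∃ ℓ : V → ℕ, (∀ v ∈ S, ℓ v = 0 ↔ v ∈ K) ∧ G.IsLayering S ℓ ∧
    G.IsShadowComplete S ℓ ∧ ∀ d, G.IsRichSum n r {v ∈ S | ℓ v = d}

theorem IsNonrepOn.hasRichLayerings {S : Set V} {n : ℕ} {φ : V → ℕ} (h : G.IsNonrepOn S n φ)
    (r : ℕ) : G.HasRichLayerings n r S := by
  classical
  intro K hKS hK
  refine ⟨fun v => if v ∈ K then 0 else 1, fun v _ => by simp, fun a b _ _ _ => ?_, ?_,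
    fun d => .of_isNonrepOn (h.mono (Set.sep_subset _ _))⟩
  · dsimp only
    split_ifs <;> omega
  · intro u z w _ _ hwu huz hzw huw
    by_cases hu : u ∈ K
    · have hw : w ∈ K := by
        by_contra hw
        simp [hu, hw] at hwu
      exact hK hu hw huw
    · rcases huz.cases_tail with rfl | ⟨y, _, hy⟩
      · exact hzw
      · have := hy.2.2
        simp only [hu, if_false] at this
        split_ifs at this <;> omega

theorem IsSeparation.exists_richLayering [Finite V] {S₁ S₂ K : Set V} {n r : ℕ}
    (hsep : G.IsSeparation S₁ S₂) (h₁ : G.HasRichLayerings n r S₁)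
    (h₂ : G.HasRichLayerings n r S₂) (hcl : G.IsClique (S₁ ∩ S₂))
    (hr : (S₁ ∩ S₂).ncard ≤ r + 1) (hKS : K ⊆ S₁) (hK : G.IsClique K) :
    ∃ ℓ : V → ℕ, (∀ v ∈ S₁ ∪ S₂, ℓ v = 0 ↔ v ∈ K) ∧ G.IsLayering (S₁ ∪ S₂) ℓ ∧
      G.IsShadowComplete (S₁ ∪ S₂) ℓ ∧ ∀ d, G.IsRichSum n r {v ∈ S₁ ∪ S₂ | ℓ v = d} := by
  classical
  obtain ⟨ℓ₁, hz₁, hlay₁, hsh₁, hd₁⟩ := h₁ K hKS hK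
  obtain ⟨i, hmin, hatt⟩ : ∃ i, (∀ q ∈ S₁ ∩ S₂, i ≤ ℓ₁ q) ∧
      ((S₁ ∩ S₂).Nonempty → ∃ q ∈ S₁ ∩ S₂, ℓ₁ q = i) := by
    rcases (S₁ ∩ S₂).eq_empty_or_nonempty with he | hne
    · exact ⟨0, fun q _ => Nat.zero_le _, fun h => absurd he h.ne_empty⟩
    · obtain ⟨q, hq, hmin⟩ := Set.exists_min_image _ ℓ₁ (Set.toFinite _) hne
      exact ⟨ℓ₁ q, hmin, fun _ => ⟨q, hq, rfl⟩⟩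
  obtain ⟨ℓ₂, hz₂, hlay₂, hsh₂, hd₂⟩ := h₂ {q ∈ S₁ ∩ S₂ | ℓ₁ q = i} (fun q hq => hq.1.2)
    (hcl.subset (Set.sep_subset _ _))
  have hQ (q : V) (hq : q ∈ S₁ ∩ S₂) : ℓ₁ q = i + ℓ₂ q ∧ ℓ₁ q ≤ i + 1 := by
    have hm := hmin q hq
    obtain ⟨q₀, hq₀, e₀⟩ := hatt ⟨q, hq⟩
    have z₀ : ℓ₂ q₀ = 0 := (hz₂ q₀ hq₀.2).2 ⟨hq₀, e₀⟩
    by_cases hqi : ℓ₁ q = i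
    · have : ℓ₂ q = 0 := (hz₂ q hq.2).2 ⟨hq, hqi⟩
      omega
    · have hne : ℓ₂ q ≠ 0 := fun h => hqi ((hz₂ q hq.2).1 h).2
      have hadj : G.Adj q q₀ := hcl hq hq₀ fun h => hqi (h ▸ e₀)
      have := hlay₁ hq.1 hq₀.1 hadj
      have := hlay₂ hq.2 hq₀.2 hadj
      omega
  obtain ⟨ℓ, e₁, e₂⟩ : ∃ ℓ : V → ℕ, (∀ v ∈ S₁, ℓ v = 0 + ℓ₁ v) ∧ ∀ v ∈ S₂, ℓ v = i + ℓ₂ v := by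
    refine ⟨fun v => if v ∈ S₁ then ℓ₁ v else i + ℓ₂ v, fun v hv => by simp [hv], fun v hv => ?_⟩
    by_cases hv₁ : v ∈ S₁
    · simpa [hv₁] using (hQ v ⟨hv₁, hv⟩).1
    · simp [hv₁]
  have hpos (v : V) (hv₂ : v ∈ S₂) (hv₁ : v ∉ S₁) : i + 1 ≤ ℓ v := by
    have : ℓ₂ v ≠ 0 := fun h => hv₁ ((hz₂ v hv₂).1 h).1.1
    have := e₂ v hv₂
    omega
  refine ⟨ℓ, fun v hv => ?_, (hlay₁.of_eq_add 0 e₁).union (hlay₂.of_eq_add i e₂) hsep,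
    (hsh₁.of_eq_add 0 e₁).union (hsh₂.of_eq_add i e₂) hsep hcl fun q hq v hv₂ hv₁ => ?_,
    fun d => ?_⟩
  · by_cases hv₁ : v ∈ S₁
    · rw [e₁ v hv₁, zero_add, hz₁ v hv₁]
    · have := hpos v (hv.resolve_left hv₁) hv₁
      exact iff_of_false (by omega) fun h => hv₁ (hKS h)
  · have := hpos v hv₂ hv₁
    have := (hQ q hq).2
    have := e₁ q hq.1
    omega
  have hL₁ : G.IsRichSum n r {v ∈ S₁ | ℓ v = d} := by
    convert hd₁ d using 1
    ext v
    exact and_congr_right fun hv => by rw [e₁ v hv, zero_add]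
  have hunion : {v ∈ S₁ ∪ S₂ | ℓ v = d} = {v ∈ S₁ | ℓ v = d} ∪ {v ∈ S₂ | ℓ v = d} := by
    ext v
    simp only [Set.mem_ofPred_eq, Set.mem_union]
    tauto
  have hinter : {v ∈ S₁ | ℓ v = d} ∩ {v ∈ S₂ | ℓ v = d} = {v ∈ S₁ ∩ S₂ | ℓ v = d} := by
    ext v
    simp only [Set.mem_ofPred_eq, Set.mem_inter_iff]
    tauto
  rw [hunion]
  by_cases hsub : {v ∈ S₂ | ℓ v = d} ⊆ S₁
  · rwa [Set.union_eq_self_of_subset_right]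
    exact fun v hv => ⟨hsub hv, hv.2⟩
  · obtain ⟨x, ⟨hx₂, hxd⟩, hx₁⟩ := Set.not_subset.1 hsub
    have hid := hpos x hx₂ hx₁
    have hL₂ : G.IsRichSum n r {v ∈ S₂ | ℓ v = d} := by
      convert hd₂ (d - i) using 1
      ext v
      refine and_congr_right fun hv => ?_
      rw [e₂ v hv]
      omega
    refine hL₁.union hL₂ ?_ ?_ ?_
    · intro a b ha hb hab
      exact (hsep ha.1 hb.1 hab).imp (fun h => ⟨h, ha.2⟩) fun h => ⟨h, hb.2⟩
    · exact hcl.subset (by rw [hinter]; exact Set.sep_subset _ _)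
    · rw [hinter]
      rcases (S₁ ∩ S₂).eq_empty_or_nonempty with he | hne
      · simp [he]
      · obtain ⟨q, hq, hqi⟩ := hatt hne
        have : {v ∈ S₁ ∩ S₂ | ℓ v = d} ⊂ S₁ ∩ S₂ := by
          refine ⟨Set.sep_subset _ _, fun h => ?_⟩
          have := (h hq).2
          have := e₁ q hq.1
          omega
        have := Set.ncard_lt_ncard this (Set.toFinite _)
        omega

theorem IsRichSum.hasRichLayerings [Finite V] {S : Set V} {n r : ℕ}
    (h : G.IsRichSum n (r + 1) S) : G.HasRichLayerings n r S := by
  induction h with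
  | of_isNonrepOn h => exact h.hasRichLayerings r
  | @union S₁ S₂ _ _ hsep hcl hr ih₁ ih₂ =>
    intro K hKS hK
    rcases hsep.subset_or_subset hK hKS with hKS | hKS
    · exact hsep.exists_richLayering ih₁ ih₂ hcl hr hKS hK
    · rw [Set.union_comm]
      rw [Set.inter_comm] at hcl hr
      exact hsep.symm.exists_richLayering ih₂ ih₁ hcl hr hKS hK

theorem IsRichSum.exists_isNonrepOn [Finite V] {n r : ℕ} {S : Set V} (h : G.IsRichSum n r S) :
    ∃ φ, G.IsNonrepOn S (n * 4 ^ r) φ := by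
  induction r generalizing S with
  | zero => simpa using h.exists_isNonrepOn_zero
  | succ r ih =>
    obtain ⟨ℓ, -, hlay, hsh, hd⟩ := h.hasRichLayerings ∅ (Set.empty_subset _) (by simp)
    rw [pow_succ, ← mul_assoc]
    exact hsh.exists_isNonrepOn hlay fun d => ih (hd d)

/-- In a tree decomposition, a vertex that occurs in bags on both sides of an edge of the tree
belongs to both bags of that edge. -/
theorem IsTreeDecomp.mem_of_reachable_deleteEdges {T : Type*} {Tg : SimpleGraph T}
    {B : T → Finset V} (hdec : G.IsTreeDecomp Tg B) {x y z w : T} {v : V}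
    (hz : (Tg.deleteEdges {s(x, y)}).Reachable x z)
    (hw : ¬ (Tg.deleteEdges {s(x, y)}).Reachable x w) (hvz : v ∈ B z) (hvw : v ∈ B w) :
    v ∈ B x ∧ v ∈ B y := by
  obtain ⟨p⟩ := (hdec.2.2.2 v).preconnected ⟨z, hvz⟩ ⟨w, hvw⟩
  obtain ⟨⟨⟨a, b⟩, hab⟩, -, ha, hb⟩ := p.exists_boundary_dart
    {t | (Tg.deleteEdges {s(x, y)}).Reachable x t} hz hw
  simp only [Set.mem_ofPred_eq] at ha hb
  have hab' : Tg.Adj a b := hab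
  by_cases he : s(a.1, b.1) = s(x, y)
  · rcases Sym2.eq_iff.1 he with ⟨h₁, h₂⟩ | ⟨h₁, h₂⟩
    · exact ⟨h₁ ▸ a.2, h₂ ▸ b.2⟩
    · exact ⟨h₂ ▸ b.2, h₁ ▸ a.2⟩
  · refine absurd (ha.trans (Adj.reachable ?_)) hb
    rw [deleteEdges_adj]
    exact ⟨hab', by simpa using he⟩

/-- Adding a leaf bag to a union of bags over a connected set of tree nodes. -/
theorem IsTreeDecomp.isRichSum_insert [DecidableEq V] {T : Type*} {Tg : SimpleGraph T}
    {B : T → Finset V} {n r : ℕ} (hdec : G.IsTreeDecomp Tg B)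
    (hrich : ∀ ⦃x y : T⦄, Tg.Adj x y →
      G.IsClique ((B x ∩ B y : Finset V) : Set V) ∧ (B x ∩ B y).card ≤ r)
    (hbag : ∀ x, ∃ φ, G.IsNonrepOn (B x) n φ) {X : Set T} {x y : T}
    (hX : ∀ z ∈ X, Relation.ReflTransGen (fun p q => Tg.Adj p q ∧ p ∈ X ∧ q ∈ X) x z)
    (hsum : G.IsRichSum n r {v | ∃ z ∈ X, v ∈ B z}) (hx : x ∈ X) (hxy : Tg.Adj x y) (hy : y ∉ X) :
    G.IsRichSum n r {v | ∃ z ∈ insert y X, v ∈ B z} := by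
  have hny : ¬ (Tg.deleteEdges {s(x, y)}).Reachable x y :=
    isBridge_iff.1 (isAcyclic_iff_forall_isBridge.1 hdec.1.isAcyclic hxy)
  have hXr : ∀ z ∈ X, (Tg.deleteEdges {s(x, y)}).Reachable x z := by
    intro z hz
    induction hX z hz with
    | refl => exact .refl _
    | @tail p q _ hpq ih =>
      refine (ih hpq.2.1).trans (Adj.reachable ?_)
      rw [deleteEdges_adj]
      refine ⟨hpq.1, fun h => ?_⟩
      rcases Sym2.eq_iff.1 (Set.mem_singleton_iff.1 h) with ⟨_, h⟩ | ⟨h, _⟩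
      · exact hy (h ▸ hpq.2.2)
      · exact hy (h ▸ hpq.2.1)
  have hinter : {v | ∃ z ∈ X, v ∈ B z} ∩ (B y : Set V) = ((B x ∩ B y : Finset V) : Set V) := by
    ext v
    simp only [Set.mem_inter_iff, Set.mem_ofPred_eq, Finset.mem_coe, Finset.mem_inter]
    constructor
    · rintro ⟨⟨z, hz, hvz⟩, hvy⟩
      exact hdec.mem_of_reachable_deleteEdges (hXr z hz) hny hvz hvy
    · exact fun h => ⟨⟨x, hx, h.1⟩, h.2⟩
  have hunion : {v | ∃ z ∈ insert y X, v ∈ B z} = {v | ∃ z ∈ X, v ∈ B z} ∪ (B y : Set V) := by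
    ext v
    simp only [Set.mem_insert_iff, exists_eq_or_imp, Set.mem_ofPred_eq, Set.mem_union,
      Finset.mem_coe]
    exact or_comm
  obtain ⟨φ, hφ⟩ := hbag y
  rw [hunion]
  refine hsum.union (.of_isNonrepOn hφ) ?_ (by rw [hinter]; exact (hrich hxy).1)
    (by rw [hinter, Set.ncard_coe_finset]; exact (hrich hxy).2)
  rintro a b ⟨z, hz, haz⟩ hb hab
  obtain ⟨w, haw, hbw⟩ := hdec.2.2.1 hab
  by_cases hw : (Tg.deleteEdges {s(x, y)}).Reachable x w
  · exact Or.inr ⟨x, hx, (hdec.mem_of_reachable_deleteEdges hw hny hbw hb).1⟩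
  · exact Or.inl (hdec.mem_of_reachable_deleteEdges (hXr z hz) hw haz haw).2

/-- A set `X` of tree nodes is connected and the union of its bags is a rich sum. -/
def IsRichSubtree {T : Type*} (G : SimpleGraph V) (Tg : SimpleGraph T) (B : T → Finset V)
    (n r : ℕ) (X : Set T) : Prop :=
  (∀ x ∈ X, ∀ z ∈ X, Relation.ReflTransGen (fun p q => Tg.Adj p q ∧ p ∈ X ∧ q ∈ X) x z) ∧
    G.IsRichSum n r {v | ∃ z ∈ X, v ∈ B z}

theorem IsTreeDecomp.exists_isRichSubtree_of_walk [DecidableEq V] {T : Type*} {Tg : SimpleGraph T}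
    {B : T → Finset V} {n r : ℕ} (hdec : G.IsTreeDecomp Tg B)
    (hrich : ∀ ⦃x y : T⦄, Tg.Adj x y →
      G.IsClique ((B x ∩ B y : Finset V) : Set V) ∧ (B x ∩ B y).card ≤ r)
    (hbag : ∀ x, ∃ φ, G.IsNonrepOn (B x) n φ) {x w : T} (p : Tg.Walk x w) {X : Set T}
    (hX : G.IsRichSubtree Tg B n r X) (hx : x ∈ X) :
    ∃ X', X ⊆ X' ∧ G.IsRichSubtree Tg B n r X' ∧ w ∈ X' := by
  induction p generalizing X with
  | nil => exact ⟨X, subset_rfl, hX, hx⟩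
  | @cons x y w hxy p ih =>
    by_cases hy : y ∈ X
    · exact ih hX hy
    · suffices H : G.IsRichSubtree Tg B n r (insert y X) by
        obtain ⟨X', hXX', hX', hw⟩ := ih H (Set.mem_insert _ _)
        exact ⟨X', (Set.subset_insert _ _).trans hXX', hX', hw⟩
      refine ⟨?_, ?_⟩
      · have hx' : x ∈ insert y X := Set.mem_insert_of_mem _ hx
        have hy' : y ∈ insert y X := Set.mem_insert _ _
        have lift (a : T) (ha : a ∈ X) (b : T) (hb : b ∈ X) : Relation.ReflTransGen
            (fun p q => Tg.Adj p q ∧ p ∈ insert y X ∧ q ∈ insert y X) a b :=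
          Relation.ReflTransGen.mono (fun p q h => ⟨h.1, .inr h.2.1, .inr h.2.2⟩) _ _
            (hX.1 a ha b hb)
        rintro a (rfl | ha) b (rfl | hb)
        · rfl
        · exact .head ⟨hxy.symm, hy', hx'⟩ (lift x hx b hb)
        · exact .tail (lift a ha x hx) ⟨hxy, hx', hy'⟩
        · exact lift a ha b hb
      · exact hdec.isRichSum_insert hrich hbag (hX.1 x hx) hX.2 hx hxy hy

theorem IsTreeDecomp.isRichSum_univ [Finite V] [DecidableEq V] {T : Type*} {Tg : SimpleGraph T}
    {B : T → Finset V} {n r : ℕ} (hdec : G.IsTreeDecomp Tg B)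
    (hrich : ∀ ⦃x y : T⦄, Tg.Adj x y →
      G.IsClique ((B x ∩ B y : Finset V) : Set V) ∧ (B x ∩ B y).card ≤ r)
    (hbag : ∀ x, ∃ φ, G.IsNonrepOn (B x) n φ) : G.IsRichSum n r Set.univ := by
  have key : ∀ s : Set V, ∃ X : Set T, X.Nonempty ∧ G.IsRichSubtree Tg B n r X ∧
      ∀ v ∈ s, ∃ x ∈ X, v ∈ B x := by
    intro s
    induction s, s.toFinite using Set.Finite.induction_on with
    | empty =>
      obtain ⟨x⟩ := hdec.1.connected.nonempty
      obtain ⟨φ, hφ⟩ := hbag x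
      refine ⟨{x}, Set.singleton_nonempty x, ⟨?_, ?_⟩, by simp⟩
      · rintro _ rfl _ rfl
        exact .refl
      · refine .of_isNonrepOn (φ := φ) ?_
        simpa using hφ
    | @insert v s _ _ ih =>
      obtain ⟨X, ⟨x, hx⟩, hX, hs⟩ := ih
      obtain ⟨w, hw⟩ := hdec.2.1 v
      obtain ⟨p⟩ := hdec.1.connected.preconnected x w
      obtain ⟨X', hXX', hX', hwX'⟩ := hdec.exists_isRichSubtree_of_walk hrich hbag p hX hx
      refine ⟨X', ⟨w, hwX'⟩, hX', ?_⟩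
      rintro u (rfl | hu)
      · exact ⟨w, hwX', hw⟩
      · obtain ⟨z, hz, huz⟩ := hs u hu
        exact ⟨z, hXX' hz, huz⟩
  obtain ⟨X, -, hX, hs⟩ := key Set.univ
  convert hX.2 using 1
  ext v
  simpa using hs v (Set.mem_univ v)

theorem IsNonrepetitiveColouring.exists_isNonrepOn {S : Set V} {n : ℕ} {φ : S → Fin n}
    (h : (G.induce S).IsNonrepetitiveColouring φ) : ∃ ψ, G.IsNonrepOn S n ψ := by
  classical
  refine ⟨fun v => if hv : v ∈ S then φ ⟨v, hv⟩ else 0, fun v hv => by simp [hv],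
    fun L₁ L₂ hne hnd hch hS heq => ?_⟩
  lift L₁ to List S using fun v hv => hS v (by simp [hv])
  lift L₂ to List S using fun v hv => hS v (by simp [hv])
  have heq' : L₁.map φ = L₂.map φ := by
    refine List.map_injective_iff.2 Fin.val_injective ?_
    rw [List.map_map, List.map_map] at heq ⊢
    convert heq using 2 <;> ext x <;> simp
  have hlen : L₁.length = L₂.length := by simpa using congrArg List.length heq'
  rw [← List.map_append] at hnd hch
  have hch' : (L₁ ++ L₂).IsChain (G.induce S).Adj := by
    rw [List.isChain_map] at hch
    exact hch
  have hne' : L₁ ++ L₂ ≠ [] := by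
    simp only [ne_eq, List.map_eq_nil_iff] at hne
    simp [hne]
  refine h (Walk.ofSupport (L₁ ++ L₂) hne' hch') ?_ L₁.length ?_ ?_
  · rw [Walk.isPath_def, Walk.support_ofSupport]
    exact hnd.of_map _
  · rw [Walk.support_ofSupport, List.length_append]
    omega
  · rw [Walk.support_ofSupport, List.map_append, ← List.length_map (f := φ), List.take_left,
      List.drop_left, heq']

theorem IsNonrepOn.exists_isNonrepetitiveColouring {n : ℕ} {φ : V → ℕ}
    (h : G.IsNonrepOn Set.univ n φ) : ∃ ψ : V → Fin n, G.IsNonrepetitiveColouring ψ := by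
  refine ⟨fun v => ⟨φ v, h.1 v trivial⟩, fun u v p hp k hk heq => ?_⟩
  refine h.2 (p.support.take k) (p.support.drop k) ?_ ?_ ?_ (fun _ _ => trivial) ?_
  · have := p.support_ne_nil
    rw [← List.length_pos_iff] at this ⊢
    rw [List.length_take]
    omega
  · rw [List.take_append_drop]
    exact hp.support_nodup
  · rw [List.take_append_drop]
    exact p.isChain_adj_support
  · rw [← List.map_take, ← List.map_drop] at heq
    simpa [Function.comp_def] using congrArg (List.map Fin.val) heq

end SimpleGraph

/-- **Lemma (Dujmović–Morin–Wood).** Let `G` be a graph that has an `r`-rich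
tree-decomposition (the intersection of the bags of adjacent tree nodes is a clique of
`G` on at most `r` vertices) such that the subgraph induced by each bag is
nonrepetitively `c`-colourable. Then `π(G) ≤ c · 4 ^ r`. -/
theorem nonrepChromNum_le_of_rich_treeDecomp (V T : Type) [Fintype V] [DecidableEq V]
    (G : SimpleGraph V) (Tg : SimpleGraph T) (B : T → Finset V) (r c : ℕ)
    (hdec : G.IsTreeDecomp Tg B)
    (hrich : ∀ ⦃x y : T⦄, Tg.Adj x y →
      G.IsClique ((B x ∩ B y : Finset V) : Set V) ∧ (B x ∩ B y).card ≤ r)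
    (hbag : ∀ x : T, ∃ φ : ((B x : Set V)) → Fin c,
      (G.induce (B x : Set V)).IsNonrepetitiveColouring φ) :
    G.nonrepChromNum ≤ c * 4 ^ r := by
  obtain ⟨φ, hφ⟩ := (hdec.isRichSum_univ (n := c) hrich fun x =>
    (hbag x).elim fun _ h => h.exists_isNonrepOn).exists_isNonrepOn
  exact Nat.sInf_le hφ.exists_isNonrepetitiveColouring
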